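/- Let O be a Dedekind domain and 𝔞, 𝔞' nonzero ideals of O. Then there is an isomorphism of O-modules 𝔞 ⊕ 𝔞' ≅ O ⊕ 𝔞𝔞'. -/

import Mathlib

/-- A linear form on an ideal `I` of a commutative ring satisfies `φ v * w = φ w * v`. -/
theorem Ideal.linearForm_mul_comm {R : Type*} [CommRing R] {I : Ideal R} (φ : I →ₗ[R] R)
    (v w : I) : φ v * (w : R) = φ w * (v : R) := by
  have h : (w : R) • v = (v : R) • w := Subtype.ext (mul_comm _ _)
  simpa [mul_comm] using congrArg φ h

/-- A linear form on `I` maps `I * J` into `J`. -/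
theorem Ideal.linearForm_mem_of_mem_mul {R : Type*} [CommRing R] {I J : Ideal R}
    (φ : I →ₗ[R] R) (q : I) (hq : (q : R) ∈ I * J) : φ q ∈ J := by
  suffices h : I * J ≤ (Submodule.comap φ J).map I.subtype by
    obtain ⟨y, hy, hyq⟩ := h hq
    rwa [← Subtype.ext hyq]
  refine Ideal.mul_le.mpr fun i hi j hj => ⟨j • ⟨i, hi⟩, ?_, mul_comm j i⟩
  rw [SetLike.mem_coe, Submodule.mem_comap, map_smul]
  exact J.mul_mem_right _ hj

/-- If some linear form on `I` takes at some point of `I` a value congruent to `1` modulo `J`,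
then `I × J ≃ R × (I * J)`. -/
def Ideal.prodEquivOfLinearForm {R : Type*} [CommRing R] {I J : Ideal R} (φ : I →ₗ[R] R)
    (x : I) (s : J) (h : (s : R) + φ x = 1) : (I × J) ≃ₗ[R] (R × ↥(I * J)) where
  toFun p := (p.2 - φ p.1, ⟨x * p.2 + p.1 * s,
    add_mem (Ideal.mul_mem_mul x.2 p.2.2) (Ideal.mul_mem_mul p.1.2 s.2)⟩)
  map_add' p q := by
    ext <;> simp <;> ring
  map_smul' c p := by
    ext <;> simp <;> ring
  invFun p := (⟨p.2, Ideal.mul_le_left p.2.2⟩ - p.1 • x,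
    p.1 • s + ⟨φ ⟨p.2, Ideal.mul_le_left p.2.2⟩,
      Ideal.linearForm_mem_of_mem_mul φ _ p.2.2⟩)
  left_inv p := by
    obtain ⟨w, u⟩ := p
    have hsum : (⟨x * u + w * s, Ideal.mul_le_left (add_mem (Ideal.mul_mem_mul x.2 u.2)
        (Ideal.mul_mem_mul w.2 s.2))⟩ : I) = (u : R) • x + (s : R) • w :=
      Subtype.ext (by simp [mul_comm])
    have hcomm := Ideal.linearForm_mul_comm φ w x
    ext
    · simp
      linear_combination (w : R) * h + hcomm
    · simp [hsum]
      linear_combination (u : R) * h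
  right_inv p := by
    obtain ⟨p, q, hq⟩ := p
    have hcomm := Ideal.linearForm_mul_comm φ ⟨q, Ideal.mul_le_left hq⟩ x
    ext
    · simp
      linear_combination p * h
    · simp at hcomm ⊢
      linear_combination q * h + hcomm

/-- In a domain, if `t * I ⊆ (x)` with `x ≠ 0`, then multiplication by `t / x` is a linear form
on `I`. -/
theorem Ideal.exists_linearForm_of_dvd {R : Type*} [CommRing R] [IsDomain R] {I : Ideal R}
    {x t : R} (hx : x ≠ 0) (h : ∀ w ∈ I, x ∣ t * w) :
    ∃ φ : I →ₗ[R] R, ∀ w : I, t * w = x * φ w := by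
  choose f hf using fun w : I => h w w.2
  refine ⟨⟨⟨f, fun v w => mul_left_cancel₀ hx ?_⟩, fun c w => mul_left_cancel₀ hx ?_⟩, hf⟩
  · rw [← hf, mul_add, ← hf, ← hf, Submodule.coe_add, mul_add]
  · simp only [RingHom.id_apply, smul_eq_mul]
    rw [← hf, mul_left_comm, ← hf, Submodule.coe_smul, smul_eq_mul, mul_left_comm]

/-- In a Dedekind domain, for nonzero ideals `I` and `J` some linear form on `I` takes a value
congruent to `1` modulo `J`. -/
theorem IsDedekindDomain.exists_linearForm_add_eq_one {R : Type*} [CommRing R]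
    [IsDedekindDomain R] {I J : Ideal R} (hI : I ≠ ⊥) (hJ : J ≠ ⊥) :
    ∃ (φ : I →ₗ[R] R) (x : I) (s : J), (s : R) + φ x = 1 := by
  obtain ⟨x, hx⟩ := IsDedekindDomain.exists_sup_span_eq (I := I * J) (J := I)
    Ideal.mul_le_left (mul_ne_zero hI hJ)
  have hxI : x ∈ I := by
    rw [← Ideal.span_singleton_le_iff_mem, ← hx]
    exact le_sup_right
  obtain ⟨b, hb⟩ := Ideal.dvd_iff_le.mpr ((Ideal.span_singleton_le_iff_mem I).mpr hxI)
  have hcop : J ⊔ b = ⊤ := by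
    rw [hb, ← Ideal.mul_sup] at hx
    exact mul_left_cancel₀ (a := I) hI (hx.trans (Ideal.mul_top I).symm)
  by_cases hx0 : x = 0
  · have hb0 : b = ⊥ := by
      have hmul : I * b = ⊥ := by rw [← hb, hx0, Ideal.span_singleton_zero]
      exact (Ideal.mul_eq_bot.mp hmul).resolve_left hI
    have hJtop : J = ⊤ := by simpa [hb0] using hcop
    exact ⟨0, 0, ⟨1, hJtop ▸ Submodule.mem_top⟩, by simp⟩
  · obtain ⟨s, hs, t, ht, hst⟩ := Submodule.mem_sup.mp
      (hcop ▸ Submodule.mem_top : (1 : R) ∈ J ⊔ b)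
    obtain ⟨φ, hφ⟩ := Ideal.exists_linearForm_of_dvd (I := I) (t := t) hx0 fun w hw => by
      rw [← Ideal.mem_span_singleton, hb, mul_comm t]
      exact Ideal.mul_mem_mul hw ht
    refine ⟨φ, ⟨x, hxI⟩, ⟨s, hs⟩, ?_⟩
    have hφx : φ ⟨x, hxI⟩ = t :=
      mul_left_cancel₀ hx0 ((hφ ⟨x, hxI⟩).symm.trans (mul_comm t x))
    rw [hφx, hst]

/-- For nonzero ideals `𝔞, 𝔞'` of a Dedekind domain `O`, there is an isomorphism of
`O`-modules `𝔞 ⊕ 𝔞' ≅ O ⊕ 𝔞𝔞'`. -/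
theorem stmt19 (O : Type*) [CommRing O] [IsDomain O] [IsDedekindDomain O]
    (a a' : Ideal O) (ha : a ≠ ⊥) (ha' : a' ≠ ⊥) :
    Nonempty ((↥a × ↥a') ≃ₗ[O] (O × ↥(a * a'))) := by
  obtain ⟨φ, x, s, h⟩ := IsDedekindDomain.exists_linearForm_add_eq_one ha ha'
  exact ⟨Ideal.prodEquivOfLinearForm φ x s h⟩
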